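/- For every integer n ≥ 3, the total number of occurrences of the pattern 123 in the set S_n(132,312) equals the sum over all compositions (c₁,…,c_k) of n of ∑_{i=1}^{k−2} c_i · binom(k−i, 2). -/

import Mathlib

open Finset

/-- Number of occurrences of the length-3 pattern `q` (given by its sequence of values)
in the permutation `σ` of `Fin n`: triples of indices `ι 0 < ι 1 < ι 2` whose values under
`σ` are in the same relative order as the values of `q`. -/
def occ (n : ℕ) (q : Fin 3 → ℕ) (σ : Equiv.Perm (Fin n)) : ℕ :=
  (Finset.univ.filter fun ι : Fin 3 → Fin n =>
    (∀ j l : Fin 3, j < l → ι j < ι l) ∧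
    (∀ j l : Fin 3, q j < q l ↔ σ (ι j) < σ (ι l))).card

/-- The set `S_n(R)` of permutations of `{1,…,n}` avoiding every pattern in `R`. -/
def avoiders (n : ℕ) (R : List (Fin 3 → ℕ)) : Finset (Equiv.Perm (Fin n)) :=
  Finset.univ.filter fun σ => ∀ q ∈ R, occ n q σ = 0

/-- `f_q(S_n(R))`: the total number of occurrences of the pattern `q` among
all permutations in `S_n(R)`. -/
def fCnt (n : ℕ) (q : Fin 3 → ℕ) (R : List (Fin 3 → ℕ)) : ℕ :=
  ∑ σ ∈ avoiders n R, occ n q σ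

def p123 : Fin 3 → ℕ := ![1, 2, 3]
def p132 : Fin 3 → ℕ := ![1, 3, 2]
def p213 : Fin 3 → ℕ := ![2, 1, 3]
def p231 : Fin 3 → ℕ := ![2, 3, 1]
def p312 : Fin 3 → ℕ := ![3, 1, 2]
def p321 : Fin 3 → ℕ := ![3, 2, 1]

/-- Sum of `j` over all pairs `j < k` in `S`: the number of triples `i < j < k` of natural
numbers with `j, k ∈ S`. -/
def pairWeight (S : Finset ℕ) : ℕ := ∑ k ∈ S, ∑ j ∈ S with j < k, j

/-- The positions of a permutation whose value exceeds that of some earlier position. -/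
def ascentPositions {n : ℕ} (σ : Equiv.Perm (Fin n)) : Finset ℕ :=
  (univ.filter fun k : Fin n => ∃ i < k, σ i < σ k).image Fin.val

theorem mem_ascentPositions {n : ℕ} {σ : Equiv.Perm (Fin n)} {k : Fin n} :
    (k : ℕ) ∈ ascentPositions σ ↔ ∃ i < k, σ i < σ k := by
  simp only [ascentPositions, mem_image, mem_filter, mem_univ, true_and]
  constructor
  · rintro ⟨a, h, e⟩
    rwa [← Fin.ext e]
  · exact fun h => ⟨k, h, rfl⟩

theorem ascentPositions_subset {n : ℕ} (σ : Equiv.Perm (Fin n)) :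
    ascentPositions σ ⊆ Ico 1 n := by
  intro x hx
  simp only [ascentPositions, mem_image, mem_filter, mem_univ, true_and] at hx
  obtain ⟨k, ⟨i, hi, -⟩, rfl⟩ := hx
  have : i.val < k.val := hi
  simp only [mem_Ico]
  omega

theorem mem_avoiders_iff {n : ℕ} {σ : Equiv.Perm (Fin n)} :
    σ ∈ avoiders n [p132, p312] ↔
      ∀ i j k : Fin n, i < j → j < k → (σ i < σ k ↔ σ j < σ k) := by
  simp only [avoiders, mem_filter, mem_univ, true_and, List.mem_cons, List.not_mem_nil, or_false,
    forall_eq_or_imp, forall_eq, occ, card_eq_zero, filter_eq_empty_iff, forall_true_left]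
  constructor
  · rintro ⟨h1, h2⟩ i j k hij hjk
    have a := @h1 ![i, j, k]
    have b := @h2 ![i, j, k]
    have nij : σ i ≠ σ j := fun h => hij.ne (σ.injective h)
    have nik : σ i ≠ σ k := fun h => (hij.trans hjk).ne (σ.injective h)
    have njk : σ j ≠ σ k := fun h => hjk.ne (σ.injective h)
    simp [Fin.forall_fin_succ, p132, p312] at a b
    grind
  · intro h
    constructor <;> rintro ι ⟨hm, hq⟩ <;>
    · have := h (ι 0) (ι 1) (ι 2) (hm 0 1 (by decide)) (hm 1 2 (by decide))
      rw [← hq, ← hq] at this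
      simp [p132, p312] at this

theorem lt_iff_mem_ascentPositions {n : ℕ} {σ : Equiv.Perm (Fin n)}
    (hσ : σ ∈ avoiders n [p132, p312]) {i k : Fin n} (hik : i < k) :
    σ i < σ k ↔ (k : ℕ) ∈ ascentPositions σ := by
  rw [mem_ascentPositions]
  constructor
  · exact fun h => ⟨i, hik, h⟩
  · rintro ⟨j, hj, h⟩
    rw [mem_avoiders_iff] at hσ
    rcases lt_trichotomy i j with hij | rfl | hij
    · exact (hσ i j k hij hj).2 h
    · exact h
    · exact (hσ j i k hij hik).1 h

theorem occ_p123 {n : ℕ} {σ : Equiv.Perm (Fin n)} (hσ : σ ∈ avoiders n [p132, p312]) :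
    occ n p123 σ = pairWeight (ascentPositions σ) := by
  have key : pairWeight (ascentPositions σ) = ((ascentPositions σ).sigma fun k =>
      ((ascentPositions σ).filter (· < k)).sigma fun j => range j).card := by
    simp [pairWeight, card_sigma]
  rw [key, occ]
  refine card_bij (fun ι _ => ⟨(ι 2 : ℕ), ⟨(ι 1 : ℕ), (ι 0 : ℕ)⟩⟩) ?_ ?_ ?_
  · intro ι hι
    simp only [mem_filter, mem_univ, true_and] at hι
    obtain ⟨hm, hq⟩ := hι
    have h01 := hm 0 1 (by decide)
    have h12 := hm 1 2 (by decide)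
    have q01 := (lt_iff_mem_ascentPositions hσ h01).1 ((hq 0 1).1 (by simp [p123]))
    have q12 := (lt_iff_mem_ascentPositions hσ h12).1 ((hq 1 2).1 (by simp [p123]))
    simp only [mem_sigma, mem_filter, mem_range]
    exact ⟨q12, ⟨q01, h12⟩, h01⟩
  · intro ι _ κ _ h
    simp only [Sigma.mk.injEq, heq_eq_eq] at h
    funext x
    fin_cases x <;> apply Fin.ext <;> simp [h.1, h.2.1, h.2.2]
  · rintro ⟨k, j, i⟩ h
    simp only [mem_sigma, mem_filter, mem_range] at h
    obtain ⟨hk, ⟨hj, hjk⟩, hij⟩ := h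
    have hkn := (mem_Ico.1 (ascentPositions_subset σ hk)).2
    let k' : Fin n := ⟨k, hkn⟩
    let j' : Fin n := ⟨j, hjk.trans hkn⟩
    let i' : Fin n := ⟨i, hij.trans (hjk.trans hkn)⟩
    have hij' : i' < j' := hij
    have hjk' : j' < k' := hjk
    have s1 : σ i' < σ j' := (lt_iff_mem_ascentPositions hσ hij').2 hj
    have s2 : σ j' < σ k' := (lt_iff_mem_ascentPositions hσ hjk').2 hk
    refine ⟨![i', j', k'], ?_, rfl⟩
    have := s1.trans s2
    have := hij'.trans hjk'
    simp only [mem_filter, mem_univ, true_and]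
    constructor
    · simp [Fin.forall_fin_succ, *]
    · simp [Fin.forall_fin_succ, p123, *, le_of_lt]

theorem ascentPositions_injOn (n : ℕ) :
    Set.InjOn (ascentPositions (n := n)) (avoiders n [p132, p312]) := by
  intro σ hσ τ hτ h
  have hlt : ∀ i j : Fin n, σ i < σ j ↔ τ i < τ j := by
    intro i j
    rcases lt_trichotomy i j with hij | rfl | hij
    · rw [lt_iff_mem_ascentPositions hσ hij, lt_iff_mem_ascentPositions hτ hij, h]
    · simp
    · have a := lt_iff_mem_ascentPositions hσ hij
      have b := lt_iff_mem_ascentPositions hτ hij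
      rw [← h, ← a] at b
      have hs : σ j ≠ σ i := fun e => hij.ne (σ.injective e)
      have ht : τ j ≠ τ i := fun e => hij.ne (τ.injective e)
      grind
  let e : Fin n ≃o Fin n :=
    { toEquiv := σ.symm.trans τ
      map_rel_iff' := by
        intro a b
        have := hlt (σ.symm b) (σ.symm a)
        simp only [Equiv.apply_symm_apply] at this
        simpa using (not_congr this).symm }
  have he : e = OrderIso.refl _ := Subsingleton.elim _ _
  ext i : 1
  have : e (σ i) = σ i := by rw [he]; rfl
  simpa [e] using this.symm

theorem exists_ascentPositions_eq {n : ℕ} {S : Finset ℕ} (hS : S ⊆ Ico 1 n) :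
    ∃ σ ∈ avoiders n [p132, p312], ascentPositions σ = S := by
  let f : ℕ → ℕ := fun k => (if k ∈ S then k else 0) + ((Ioo k n).filter (· ∉ S)).card
  have hf : ∀ k < n, f k < n := by
    intro k hk
    have : ((Ioo k n).filter (· ∉ S)).card ≤ n - k - 1 :=
      (card_filter_le _ _).trans (by simp)
    simp only [f]
    split_ifs <;> omega
  have up : ∀ i k, i < k → k < n → k ∈ S → f i < f k := by
    intro i k hik hkn hk
    have hsub : (Ioo i n).filter (· ∉ S) ⊆
        Ioo i k ∪ (Ioo k n).filter (· ∉ S) := by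
      intro x hx
      simp only [mem_union, mem_filter, mem_Ioo] at hx ⊢
      have : x ≠ k := by rintro rfl; exact hx.2 hk
      have := hx.2
      by_cases x < k
      · left; omega
      · right; exact ⟨by omega, this⟩
    have := (card_le_card hsub).trans (card_union_le _ _)
    simp only [Nat.card_Ioo] at this
    simp only [f, if_pos hk]
    split_ifs <;> omega
  have down : ∀ i k, i < k → k < n → k ∉ S → f k < f i := by
    intro i k hik hkn hk
    have : ((Ioo k n).filter (· ∉ S)).card < ((Ioo i n).filter (· ∉ S)).card := by
      apply card_lt_card
      rw [ssubset_iff_of_subset]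
      · exact ⟨k, by simp [*], by simp⟩
      · intro x hx
        simp only [mem_filter, mem_Ioo] at hx ⊢
        exact ⟨by omega, hx.2⟩
    simp only [f, if_neg hk]
    omega
  have iff_mem : ∀ i k, i < k → k < n → (f i < f k ↔ k ∈ S) := fun i k hik hk =>
    ⟨fun h => by_contra fun hn => (down i k hik hk hn).asymm h, up i k hik hk⟩
  let g : Fin n → Fin n := fun k => ⟨f k, hf k k.2⟩
  have hg : Function.Injective g := by
    have ne : ∀ i k : Fin n, i < k → g i ≠ g k := by
      intro i k hik h
      have h : f i = f k := congrArg Fin.val h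
      by_cases hk : (k : ℕ) ∈ S
      · exact (up i k hik k.2 hk).ne h
      · exact (down i k hik k.2 hk).ne h.symm
    intro i k h
    rcases lt_trichotomy i k with hik | rfl | hik
    · exact (ne i k hik h).elim
    · rfl
    · exact (ne k i hik h.symm).elim
  let σ : Equiv.Perm (Fin n) := Equiv.ofBijective g (Finite.injective_iff_bijective.1 hg)
  have hσ : ∀ i k : Fin n, i < k → (σ i < σ k ↔ (k : ℕ) ∈ S) :=
    fun i k hik => iff_mem i k hik k.2
  refine ⟨σ, mem_avoiders_iff.2 fun i j k hij hjk => ?_, ?_⟩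
  · rw [hσ _ _ (hij.trans hjk), hσ _ _ hjk]
  · ext x
    constructor
    · intro hx
      have hxn := (mem_Ico.1 (ascentPositions_subset σ hx)).2
      obtain ⟨i, hi, h⟩ := (mem_ascentPositions (k := ⟨x, hxn⟩)).1 hx
      exact (hσ _ _ hi).1 h
    · intro hx
      have hxn := mem_Ico.1 (hS hx)
      have h0 : (⟨0, by omega⟩ : Fin n) < ⟨x, hxn.2⟩ := hxn.1
      exact (mem_ascentPositions (k := ⟨x, hxn.2⟩)).2 ⟨_, h0, (hσ _ _ h0).2 hx⟩

theorem fCnt_p123 (n : ℕ) :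
    fCnt n p123 [p132, p312] = ∑ S ∈ (Ico 1 n).powerset, pairWeight S := by
  refine sum_bij (fun σ _ => ascentPositions σ) ?_ ?_ ?_ ?_
  · exact fun σ _ => mem_powerset.2 (ascentPositions_subset σ)
  · exact fun σ hσ τ hτ h => ascentPositions_injOn n hσ hτ h
  · intro S hS
    obtain ⟨σ, hσ, h⟩ := exists_ascentPositions_eq (mem_powerset.1 hS)
    exact ⟨σ, hσ, h⟩
  · exact fun σ hσ => occ_p123 hσ

/-- The partial sums of a composition strictly between `0` and `n`. -/
def innerBoundaries {n : ℕ} (c : Composition n) : Finset ℕ :=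
  (Ico 1 c.length).image c.sizeUpTo

theorem Composition.sizeUpTo_lt_sizeUpTo {n : ℕ} (c : Composition n) {a b : ℕ} (hab : a < b)
    (hb : b ≤ c.length) : c.sizeUpTo a < c.sizeUpTo b :=
  (c.sizeUpTo_strict_mono (hab.trans_le hb)).trans_le (c.monotone_sizeUpTo hab)

theorem innerBoundaries_subset {n : ℕ} (c : Composition n) : innerBoundaries c ⊆ Ico 1 n := by
  intro x hx
  simp only [innerBoundaries, mem_image, mem_Ico] at hx ⊢
  obtain ⟨a, ⟨h1, h2⟩, rfl⟩ := hx
  have u := c.sizeUpTo_lt_sizeUpTo h1 h2.le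
  have v := c.sizeUpTo_lt_sizeUpTo h2 le_rfl
  rw [c.sizeUpTo_length] at v
  omega

theorem mem_boundaries_iff {n : ℕ} (c : Composition n) (x : Fin (n + 1)) :
    x ∈ c.boundaries ↔ (x : ℕ) = 0 ∨ (x : ℕ) = n ∨ (x : ℕ) ∈ innerBoundaries c := by
  simp only [Composition.boundaries, mem_map, mem_univ, true_and, innerBoundaries, mem_image,
    mem_Ico]
  constructor
  · rintro ⟨a, rfl⟩
    change c.sizeUpTo a = 0 ∨ c.sizeUpTo a = n ∨ _
    rcases Nat.eq_zero_or_pos (a : ℕ) with h | h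
    · left; rw [h, c.sizeUpTo_zero]
    · right
      rcases (Nat.lt_succ_iff.1 a.2).eq_or_lt with h' | h'
      · left; rw [h', c.sizeUpTo_length]
      · right; exact ⟨a, ⟨h, h'⟩, rfl⟩
  · rintro (h | h | ⟨a, ⟨h1, h2⟩, h⟩)
    · exact ⟨0, Fin.ext (by rw [h]; exact c.sizeUpTo_zero)⟩
    · exact ⟨Fin.last _, Fin.ext (by rw [h]; exact c.sizeUpTo_length)⟩
    · exact ⟨⟨a, by omega⟩, Fin.ext h⟩

theorem innerBoundaries_injective (n : ℕ) :
    Function.Injective (innerBoundaries : Composition n → Finset ℕ) := by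
  intro c d h
  apply (compositionEquiv n).injective
  apply CompositionAsSet.ext
  change c.boundaries = d.boundaries
  ext x
  rw [mem_boundaries_iff, mem_boundaries_iff, h]

theorem sum_pairWeight_innerBoundaries (n : ℕ) :
    ∑ c : Composition n, pairWeight (innerBoundaries c) =
      ∑ S ∈ (Ico 1 n).powerset, pairWeight S := by
  have h : univ.image (innerBoundaries : Composition n → Finset ℕ) = (Ico 1 n).powerset := by
    apply eq_of_subset_of_card_le
    · intro S hS
      obtain ⟨c, -, rfl⟩ := mem_image.1 hS
      exact mem_powerset.2 (innerBoundaries_subset c)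
    · rw [card_image_of_injective _ (innerBoundaries_injective n), card_powerset, card_univ,
        composition_card, Nat.card_Ico]
  rw [← h, sum_image (innerBoundaries_injective n).injOn]

theorem sum_range_sum_range (g : ℕ → ℕ) (L : ℕ) :
    ∑ a ∈ range L, ∑ i ∈ range a, g i = ∑ i ∈ range L, g i * (L - 1 - i) := by
  induction L with
  | zero => simp
  | succ L ih =>
    rw [sum_range_succ, ih, sum_range_succ, Nat.add_sub_cancel, Nat.sub_self, mul_zero, add_zero,
      ← sum_add_distrib]
    refine sum_congr rfl fun i hi => ?_
    have : L - i = L - 1 - i + 1 := by have := mem_range.1 hi; omega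
    rw [this, mul_add, mul_one]

theorem sum_range_sum_range_sum_range (g : ℕ → ℕ) (L : ℕ) :
    ∑ b ∈ range L, ∑ a ∈ range b, ∑ i ∈ range a, g i =
      ∑ i ∈ range L, g i * (L - 1 - i).choose 2 := by
  induction L with
  | zero => simp
  | succ L ih =>
    rw [sum_range_succ, ih, sum_range_succ, Nat.add_sub_cancel, Nat.sub_self,
      Nat.choose_eq_zero_of_lt two_pos, mul_zero, add_zero, sum_range_sum_range,
      ← sum_add_distrib]
    refine sum_congr rfl fun i hi => ?_
    have : L - i = L - 1 - i + 1 := by have := mem_range.1 hi; omega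
    rw [this, Nat.choose_succ_succ' _ 1, Nat.choose_one_right, mul_add, add_comm]

theorem List.sum_take_eq_sum_getD (l : List ℕ) (a : ℕ) :
    (l.take a).sum = ∑ i ∈ Finset.range a, l.getD i 0 := by
  induction a with
  | zero => simp
  | succ a ih =>
    rw [Finset.sum_range_succ, ← ih, List.take_add_one, List.sum_append, List.getD_eq_getElem?_getD]
    cases l[a]? <;> simp

theorem pairWeight_innerBoundaries {n : ℕ} (c : Composition n) :
    pairWeight (innerBoundaries c) = ∑ i ∈ range (c.length - 2),
      c.blocks.getD i 0 * (c.length - 1 - i).choose 2 := by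
  have hmono : StrictMonoOn c.sizeUpTo (Ico 1 c.length : Finset ℕ) := fun a _ b hb hab =>
    c.sizeUpTo_lt_sizeUpTo hab (mem_Ico.1 (mem_coe.1 hb)).2.le
  have hpairs : pairWeight (innerBoundaries c) =
      ∑ b ∈ range c.length, ∑ a ∈ range b, c.sizeUpTo a := by
    rw [pairWeight, innerBoundaries, sum_image hmono.injOn]
    have hsub : Ico 1 c.length ⊆ range c.length := by
      intro x; simp
    rw [← sum_subset hsub]
    · refine sum_congr rfl fun b hb => ?_
      rw [sum_filter, sum_image hmono.injOn, ← sum_filter]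
      refine sum_subset_zero_on_sdiff ?_ ?_ fun _ _ => rfl
      · intro a ha
        rw [mem_filter] at ha
        exact mem_range.2 ((hmono.lt_iff_lt ha.1 hb).1 ha.2)
      · intro a ha
        simp only [mem_sdiff, mem_range, mem_filter, not_and, mem_Ico] at ha
        have : a = 0 := by
          by_contra h0
          exact ha.2 ⟨by omega, ha.1.trans (mem_Ico.1 hb).2⟩
            (c.sizeUpTo_lt_sizeUpTo ha.1 (mem_Ico.1 hb).2.le)
        rw [this, c.sizeUpTo_zero]
    · intro b hb hb'
      have : b = 0 := by simp at hb hb'; omega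
      simp [this]
  rw [hpairs]
  simp only [Composition.sizeUpTo, List.sum_take_eq_sum_getD]
  rw [sum_range_sum_range_sum_range]
  refine (sum_subset (range_subset_range.2 (Nat.sub_le _ _)) fun i _ hi => ?_).symm
  rw [Nat.choose_eq_zero_of_lt, mul_zero]
  rw [mem_range] at hi
  omega

/-- Proposition `pd`: for `n ≥ 3`, `f_{123}(S_n(132,312))` is the sum over all compositions
`(c₁,…,c_k)` of `n` of `∑_{i=1}^{k−2} c_i·C(k−i, 2)` (written with 0-indexed parts:
`∑_{i=0}^{k−3} c_{i+1}·C(k−1−i, 2)`). -/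
theorem stmt_7 (n : ℕ) (hn : 3 ≤ n) :
    fCnt n p123 [p132, p312] =
      ∑ c : Composition n, ∑ i ∈ Finset.range (c.length - 2),
        c.blocks.getD i 0 * (c.length - 1 - i).choose 2 := by
  rw [fCnt_p123, ← sum_pairWeight_innerBoundaries]
  exact sum_congr rfl fun c _ => pairWeight_innerBoundaries c
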